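/- Let Ψ : 𝒳 × 𝒫 → ℝ be a core. Then Ψ satisfies (B1) strong law invariance (Ψ(X|P) = Ψ(Y|Q) whenever F_{X|P} = F_{Y|Q}), and for every fixed P ∈ 𝒫 the map X ↦ Ψ(X|P) is monotone (X ≤ Y pointwise implies Ψ(X|P) ≤ Ψ(Y|P)), cash-additive (Ψ(X+m|P) = Ψ(X|P) + m for m ∈ ℝ), positively homogeneous (Ψ(λX|P) = λΨ(X|P) for λ > 0), subadditive (Ψ(X+Y|P) ≤ Ψ(X|P) + Ψ(Y|P)), and comonotonic additive (Ψ(X+Y|P) = Ψ(X|P) + Ψ(Y|P) whenever X and Y are comonotonic), if and only if there exists an increasing concave function h : [0,1] → [0,1] with h(0) = 0 and h(1) = 1 such that Ψ(X|P) = ∫ X d(h∘P) for all X ∈ 𝒳 and P ∈ 𝒫. -/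

import Mathlib

open MeasureTheory Set

noncomputable section

/-- The uniform distribution on `[0,1]`. -/
def unif01 : Measure ℝ := volume.restrict (Icc (0:ℝ) 1)

/-- A probability measure is atomless (in the sense of the paper) if some measurable
real-valued map pushes it forward to the uniform distribution on `[0,1]`. -/
def IsAtomlessProb {Ω : Type*} [MeasurableSpace Ω] (P : Measure Ω) : Prop :=
  IsProbabilityMeasure P ∧ ∃ U : Ω → ℝ, Measurable U ∧ P.map U = unif01

/-- Membership in `𝒳`: bounded measurable real-valued functions. -/
def BddMeas {Ω : Type*} [MeasurableSpace Ω] (X : Ω → ℝ) : Prop :=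
  Measurable X ∧ ∃ C : ℝ, ∀ ω, |X ω| ≤ C

/-- Two functions are comonotonic. -/
def Comonotone {Ω : Type*} (X Y : Ω → ℝ) : Prop :=
  ∀ ω ω', 0 ≤ (X ω - X ω') * (Y ω - Y ω')

/-- The Choquet integral `∫ X d(h ∘ P)
  = ∫_{-∞}^0 (h(P(X ≥ x)) − 1) dx + ∫_0^∞ h(P(X ≥ x)) dx`. -/
def choquet {Ω : Type*} [MeasurableSpace Ω] (h : ℝ → ℝ) (P : Measure Ω) (X : Ω → ℝ) : ℝ :=
  (∫ x in Iic (0:ℝ), (h (P {ω | x ≤ X ω}).toReal - 1)) +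
    ∫ x in Ioi (0:ℝ), h (P {ω | x ≤ X ω}).toReal

section Discrete

variable {Ω : Type*}

lemma sum_levels_add_indicator {ν : Set Ω → ℝ} (hν : ν ∅ = 0) {N N' : Ω → ℕ} {M : ℕ}
    {A : Set Ω} (hN : ∀ ω, N ω ≤ M) (hN' : ∀ ω, N' ω = N ω + A.indicator 1 ω) :
    (∑ k ∈ Finset.range M, ν {ω | k + 1 ≤ N ω}) + ν A
        - ∑ k ∈ Finset.range (M + 1), ν {ω | k + 1 ≤ N' ω}
      = ∑ k ∈ Finset.range (M + 1),
          (ν {ω | k + 1 ≤ N ω} + ν ({ω | k ≤ N ω} ∩ A)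
            - (ν ({ω | k + 1 ≤ N ω} ∪ {ω | k ≤ N ω} ∩ A)
              + ν ({ω | k + 1 ≤ N ω} ∩ ({ω | k ≤ N ω} ∩ A)))) := by
  have hset : ∀ k, {ω | k + 1 ≤ N ω} ∪ {ω | k ≤ N ω} ∩ A = {ω | k + 1 ≤ N' ω} := by
    intro k
    ext ω
    by_cases hA : ω ∈ A <;> simp [hN', hA]
    omega
  have hset' : ∀ k, {ω | k + 1 ≤ N ω} ∩ ({ω | k ≤ N ω} ∩ A) = {ω | k + 1 ≤ N ω} ∩ A := by
    intro k
    ext ω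
    simp only [mem_inter_iff, mem_ofPred_eq]
    constructor
    · tauto
    · rintro ⟨h1, h2⟩
      exact ⟨h1, by omega, h2⟩
  have htop : {ω | M + 1 ≤ N ω} = ∅ :=
    eq_empty_of_forall_notMem fun ω hω => by
      have := hN ω
      simp only [mem_ofPred_eq] at hω
      omega
  have htel := Finset.sum_range_sub' (fun k => ν ({ω | k ≤ N ω} ∩ A)) (M + 1)
  simp only [htop, empty_inter, hν, Nat.zero_le, ofPred_true, univ_inter, sub_zero] at htel
  simp only [hset, hset', ← htel, Finset.sum_sub_distrib, Finset.sum_add_distrib]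
  rw [Finset.sum_range_succ (fun k => ν {ω | k + 1 ≤ N ω}) M, htop, hν]
  ring

lemma add_indicator_le {N N' : Ω → ℕ} {M : ℕ} {A : Set Ω} (hN : ∀ ω, N ω ≤ M)
    (hN' : ∀ ω, N' ω = N ω + A.indicator 1 ω) (ω : Ω) : N' ω ≤ M + 1 := by
  have := hN ω
  by_cases hA : ω ∈ A <;> simp [hN', hA] <;> omega

lemma min_succ_eq_add_indicator (N : Ω → ℕ) (K : ℕ) (ω : Ω) :
    min (N ω) (K + 1) = min (N ω) K + {ω | K + 1 ≤ N ω}.indicator 1 ω := by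
  by_cases hω : ω ∈ {ω | K + 1 ≤ N ω}
  · rw [indicator_of_mem hω, Pi.one_apply]
    rw [mem_ofPred_eq] at hω
    omega
  · rw [indicator_of_notMem hω]
    rw [mem_ofPred_eq] at hω
    omega

/-- The integer part of `n * (X + C)`, used to discretize `X`. -/
def discretize (X : Ω → ℝ) (C : ℝ) (n : ℕ) (ω : Ω) : ℕ := ⌊(n : ℝ) * (X ω + C)⌋₊

lemma discretize_le {X : Ω → ℝ} {C : ℝ} (hC : ∀ ω, |X ω| ≤ C) (n : ℕ) (ω : Ω) :
    discretize X C n ω ≤ ⌊(n : ℝ) * (C + C)⌋₊ := by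
  refine Nat.floor_le_floor ?_
  gcongr
  exact (abs_le.1 (hC ω)).2

lemma cast_discretize_le {X : Ω → ℝ} {C : ℝ} (hC : ∀ ω, |X ω| ≤ C) (n : ℕ) (ω : Ω) :
    (discretize X C n ω : ℝ) ≤ n * (X ω + C) :=
  Nat.floor_le (mul_nonneg (Nat.cast_nonneg _) (by linarith [(abs_le.1 (hC ω)).1]))

lemma le_cast_discretize_add_one (X : Ω → ℝ) (C : ℝ) (n : ℕ) (ω : Ω) :
    n * (X ω + C) ≤ (discretize X C n ω : ℝ) + 1 :=
  (Nat.lt_floor_add_one _).le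

end Discrete

section Choquet

variable {Ω : Type*} [MeasurableSpace Ω] {h : ℝ → ℝ} {P : Measure Ω} {X Y : Ω → ℝ}

lemma toReal_mem_Icc [IsProbabilityMeasure P] (A : Set Ω) : (P A).toReal ∈ Icc (0:ℝ) 1 :=
  ⟨ENNReal.toReal_nonneg, measureReal_le_one⟩

lemma toReal_mono_of_subset [IsProbabilityMeasure P] {A B : Set Ω} (hAB : A ⊆ B) :
    (P A).toReal ≤ (P B).toReal :=
  measureReal_mono hAB

lemma distortion_mono [IsProbabilityMeasure P] (hm : MonotoneOn h (Icc (0:ℝ) 1)) {A B : Set Ω}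
    (hAB : A ⊆ B) : h (P A).toReal ≤ h (P B).toReal :=
  hm (toReal_mem_Icc A) (toReal_mem_Icc B) (toReal_mono_of_subset hAB)

lemma antitone_distortion [IsProbabilityMeasure P] (hm : MonotoneOn h (Icc (0:ℝ) 1))
    (X : Ω → ℝ) : Antitone fun x => h (P {ω | x ≤ X ω}).toReal :=
  fun _ _ hxy => distortion_mono hm fun _ hω => le_trans hxy hω

lemma ConcaveOn.add_le_add_of_add_eq {s : Set ℝ} (hc : ConcaveOn ℝ s h) {a b c d : ℝ}
    (hcs : c ∈ s) (hds : d ∈ s) (hca : c ≤ a) (had : a ≤ d) (hsum : a + b = c + d) :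
    h c + h d ≤ h a + h b := by
  rcases (hca.trans had).eq_or_lt with rfl | hlt
  · obtain rfl : a = c := le_antisymm had hca
    obtain rfl : b = a := by linarith
    exact le_rfl
  have hpos : 0 < d - c := sub_pos.2 hlt
  have hne := hpos.ne'
  have hw : (d - a) / (d - c) + (a - c) / (d - c) = 1 := by field_simp; ring
  have h1 := hc.2 hcs hds (div_nonneg (sub_nonneg.2 had) hpos.le)
    (div_nonneg (sub_nonneg.2 hca) hpos.le) hw
  have h2 := hc.2 hcs hds (div_nonneg (sub_nonneg.2 hca) hpos.le)
    (div_nonneg (sub_nonneg.2 had) hpos.le) (by rw [add_comm]; exact hw)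
  simp only [smul_eq_mul] at h1 h2
  have ea : (d - a) / (d - c) * c + (a - c) / (d - c) * d = a := by field_simp; ring
  have eb : (a - c) / (d - c) * c + (d - a) / (d - c) * d = b := by
    obtain rfl : b = c + d - a := by linarith
    field_simp; ring
  rw [ea] at h1
  rw [eb] at h2
  have e : h c + h d = ((d - a) / (d - c) + (a - c) / (d - c)) * h c
      + ((d - a) / (d - c) + (a - c) / (d - c)) * h d := by rw [hw]; ring
  linarith

lemma distortion_submodular [IsProbabilityMeasure P] (hc : ConcaveOn ℝ (Icc (0:ℝ) 1) h)
    {A B : Set Ω} (hB : MeasurableSet B) :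
    h (P (A ∪ B)).toReal + h (P (A ∩ B)).toReal ≤ h (P A).toReal + h (P B).toReal := by
  rw [add_comm]
  refine hc.add_le_add_of_add_eq (toReal_mem_Icc _) (toReal_mem_Icc _)
    (toReal_mono_of_subset inter_subset_left) (toReal_mono_of_subset subset_union_left) ?_
  have := measureReal_union_add_inter (μ := P) (s := A) hB
  simp only [measureReal_def] at this
  linarith

lemma choquet_eq_intervalIntegral [IsProbabilityMeasure P] (hm : MonotoneOn h (Icc (0:ℝ) 1))
    (h0 : h 0 = 0) (h1 : h 1 = 1) {a b : ℝ} (ha : a ≤ 0) (hb : 0 ≤ b)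
    (haX : ∀ ω, a ≤ X ω) (hXb : ∀ ω, X ω ≤ b) :
    choquet h P X = a + ∫ x in a..b, h (P {ω | x ≤ X ω}).toReal := by
  have hint : ∀ u v : ℝ, IntervalIntegrable (fun x => h (P {ω | x ≤ X ω}).toReal) volume u v :=
    fun u v => ((antitone_distortion hm X).antitoneOn _).intervalIntegrable
  have e1 : ∫ x in Iic (0:ℝ), (h (P {ω | x ≤ X ω}).toReal - 1)
      = ∫ x in a..0, (h (P {ω | x ≤ X ω}).toReal - 1) := by
    rw [intervalIntegral.integral_of_le ha]
    refine setIntegral_eq_of_subset_of_forall_sdiff_eq_zero measurableSet_Iic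
      Ioc_subset_Iic_self fun x hx => ?_
    have hxa : x ≤ a := by
      by_contra hxa
      exact hx.2 ⟨not_le.1 hxa, hx.1⟩
    have : {ω | x ≤ X ω} = univ := eq_univ_of_forall fun ω => hxa.trans (haX ω)
    simp [this, h1]
  have e2 : ∫ x in Ioi (0:ℝ), h (P {ω | x ≤ X ω}).toReal
      = ∫ x in (0:ℝ)..b, h (P {ω | x ≤ X ω}).toReal := by
    rw [intervalIntegral.integral_of_le hb]
    refine setIntegral_eq_of_subset_of_forall_sdiff_eq_zero measurableSet_Ioi
      Ioc_subset_Ioi_self fun x hx => ?_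
    have hxb : b < x := by
      by_contra hxb
      exact hx.2 ⟨hx.1, not_lt.1 hxb⟩
    have : {ω | x ≤ X ω} = ∅ :=
      eq_empty_of_forall_notMem fun ω hω => absurd (hω.trans (hXb ω)) (not_le.2 hxb)
    simp [this, h0]
  rw [choquet, e1, e2, intervalIntegral.integral_sub (hint _ _) (by simp),
    ← intervalIntegral.integral_add_adjacent_intervals (hint a 0) (hint 0 b)]
  simp
  ring

lemma choquet_mono [IsProbabilityMeasure P] (hm : MonotoneOn h (Icc (0:ℝ) 1))
    (h0 : h 0 = 0) (h1 : h 1 = 1) (hX : BddMeas X) (hY : BddMeas Y) (hXY : ∀ ω, X ω ≤ Y ω) :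
    choquet h P X ≤ choquet h P Y := by
  obtain ⟨-, C, hC⟩ := hX
  obtain ⟨-, D, hD⟩ := hY
  have hE : 0 ≤ max (max C D) 0 := le_max_right _ _
  set E := max (max C D) 0
  have hCE : C ≤ E := (le_max_left C D).trans (le_max_left _ _)
  have hDE : D ≤ E := (le_max_right C D).trans (le_max_left _ _)
  rw [choquet_eq_intervalIntegral hm h0 h1 (neg_nonpos.2 hE) hE
      (fun ω => (abs_le.1 ((hC ω).trans hCE)).1) (fun ω => (abs_le.1 ((hC ω).trans hCE)).2),
    choquet_eq_intervalIntegral hm h0 h1 (neg_nonpos.2 hE) hE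
      (fun ω => (abs_le.1 ((hD ω).trans hDE)).1) (fun ω => (abs_le.1 ((hD ω).trans hDE)).2)]
  gcongr
  refine intervalIntegral.integral_mono_on (by linarith)
    ((antitone_distortion hm X).antitoneOn _).intervalIntegrable
    ((antitone_distortion hm Y).antitoneOn _).intervalIntegrable fun x _ => ?_
  exact distortion_mono hm fun ω hω => le_trans hω (hXY ω)

lemma choquet_add_const [IsProbabilityMeasure P] (hm : MonotoneOn h (Icc (0:ℝ) 1))
    (h0 : h 0 = 0) (h1 : h 1 = 1) (hX : BddMeas X) (m : ℝ) :
    choquet h P (fun ω => X ω + m) = choquet h P X + m := by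
  obtain ⟨-, C, hC⟩ := hX
  have hE : 0 ≤ max C 0 := le_max_right _ _
  have hCE : ∀ ω, |X ω| ≤ max C 0 := fun ω => (hC ω).trans (le_max_left _ _)
  set E := max C 0
  have k1 := neg_abs_le m
  have k2 := le_abs_self m
  rw [choquet_eq_intervalIntegral (a := -E - |m|) (b := E + |m|) hm h0 h1 (by linarith)
      (by linarith) (fun ω => by linarith [(abs_le.1 (hCE ω)).1])
      (fun ω => by linarith [(abs_le.1 (hCE ω)).2]),
    choquet_eq_intervalIntegral (a := -E - |m| - m) (b := E + |m| - m) hm h0 h1 (by linarith)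
      (by linarith) (fun ω => by linarith [(abs_le.1 (hCE ω)).1])
      (fun ω => by linarith [(abs_le.1 (hCE ω)).2]),
    ← intervalIntegral.integral_comp_sub_right (fun x => h (P {ω | x ≤ X ω}).toReal) m]
  simp only [sub_le_iff_le_add]
  ring

lemma choquet_const_mul [IsProbabilityMeasure P] (hm : MonotoneOn h (Icc (0:ℝ) 1))
    (h0 : h 0 = 0) (h1 : h 1 = 1) (hX : BddMeas X) {l : ℝ} (hl : 0 < l) :
    choquet h P (fun ω => l * X ω) = l * choquet h P X := by
  obtain ⟨-, C, hC⟩ := hX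
  have hE : 0 ≤ max C 0 := le_max_right _ _
  have hCE : ∀ ω, |X ω| ≤ max C 0 := fun ω => (hC ω).trans (le_max_left _ _)
  set E := max C 0
  rw [choquet_eq_intervalIntegral (a := l * -E) (b := l * E) hm h0 h1
      (mul_nonpos_of_nonneg_of_nonpos hl.le (neg_nonpos.2 hE)) (mul_nonneg hl.le hE)
      (fun ω => mul_le_mul_of_nonneg_left (abs_le.1 (hCE ω)).1 hl.le)
      (fun ω => mul_le_mul_of_nonneg_left (abs_le.1 (hCE ω)).2 hl.le),
    choquet_eq_intervalIntegral (a := -E) (b := E) hm h0 h1 (neg_nonpos.2 hE) hE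
      (fun ω => (abs_le.1 (hCE ω)).1) (fun ω => (abs_le.1 (hCE ω)).2),
    mul_add, ← smul_eq_mul (a := l) (b := ∫ x in -E..E, _),
    ← intervalIntegral.smul_integral_comp_mul_left (c := l)
      (f := fun x => h (P {ω | x ≤ l * X ω}).toReal)]
  simp only [mul_le_mul_iff_right₀ hl, smul_eq_mul]

lemma choquet_natCast [IsProbabilityMeasure P] (hm : MonotoneOn h (Icc (0:ℝ) 1))
    (h0 : h 0 = 0) (h1 : h 1 = 1) {N : Ω → ℕ} {M : ℕ} (hN : ∀ ω, N ω ≤ M) :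
    choquet h P (fun ω => (N ω : ℝ))
      = ∑ k ∈ Finset.range M, h (P {ω | k + 1 ≤ N ω}).toReal := by
  rw [choquet_eq_intervalIntegral (a := 0) (b := M) hm h0 h1 le_rfl (Nat.cast_nonneg M)
    (fun ω => Nat.cast_nonneg _) (fun ω => Nat.cast_le.2 (hN ω)), zero_add,
    ← Nat.cast_zero, ← intervalIntegral.sum_integral_adjacent_intervals (a := fun k : ℕ => (k:ℝ))
      fun k _ => ((antitone_distortion hm _).antitoneOn _).intervalIntegrable]
  refine Finset.sum_congr rfl fun k _ => ?_
  have : ∫ x in (k:ℝ)..((k + 1 : ℕ) : ℝ), h (P {ω | x ≤ (N ω : ℝ)}).toReal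
      = ∫ x in (k:ℝ)..((k + 1 : ℕ) : ℝ), h (P {ω | k + 1 ≤ N ω}).toReal := by
    refine intervalIntegral.integral_congr_ae (Filter.Eventually.of_forall fun x hx => ?_)
    rw [uIoc_of_le (by simp)] at hx
    congr 3
    ext ω
    simp only [mem_ofPred_eq]
    constructor
    · intro hxN
      exact Nat.succ_le_of_lt (Nat.cast_lt.1 (hx.1.trans_le hxN))
    · intro hkN
      exact hx.2.trans (Nat.cast_le.2 hkN)
  rw [this]
  simp

lemma bddMeas_natCast {N : Ω → ℕ} (hN : Measurable N) {M : ℕ} (hM : ∀ ω, N ω ≤ M) :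
    BddMeas fun ω => (N ω : ℝ) :=
  ⟨measurable_from_top.comp hN, M, fun ω => by
    rw [Nat.abs_cast]; exact Nat.cast_le.2 (hM ω)⟩

lemma choquet_add_indicator_le [IsProbabilityMeasure P] (hm : MonotoneOn h (Icc (0:ℝ) 1))
    (hc : ConcaveOn ℝ (Icc (0:ℝ) 1) h) (h0 : h 0 = 0) (h1 : h 1 = 1) {N N' : Ω → ℕ} {M : ℕ}
    {A : Set Ω} (hNm : Measurable N) (hA : MeasurableSet A) (hN : ∀ ω, N ω ≤ M)
    (hN' : ∀ ω, N' ω = N ω + A.indicator 1 ω) :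
    choquet h P (fun ω => (N' ω : ℝ)) ≤ choquet h P (fun ω => (N ω : ℝ)) + h (P A).toReal := by
  rw [choquet_natCast hm h0 h1 hN, choquet_natCast hm h0 h1 (add_indicator_le hN hN'),
    ← sub_nonneg, sum_levels_add_indicator (ν := fun B => h (P B).toReal) (by simp [h0]) hN hN']
  exact Finset.sum_nonneg fun k _ => sub_nonneg.2
    (distortion_submodular hc ((measurableSet_le measurable_const hNm).inter hA))

lemma choquet_add_indicator_eq [IsProbabilityMeasure P] (hm : MonotoneOn h (Icc (0:ℝ) 1))
    (h0 : h 0 = 0) (h1 : h 1 = 1) {N N' : Ω → ℕ} {M : ℕ}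
    {A : Set Ω} (hN : ∀ ω, N ω ≤ M) (hN' : ∀ ω, N' ω = N ω + A.indicator 1 ω)
    (hcomp : ∀ k, A ⊆ {ω | k ≤ N ω} ∨ {ω | k ≤ N ω} ⊆ A) :
    choquet h P (fun ω => (N' ω : ℝ)) = choquet h P (fun ω => (N ω : ℝ)) + h (P A).toReal := by
  rw [choquet_natCast hm h0 h1 hN, choquet_natCast hm h0 h1 (add_indicator_le hN hN'),
    eq_comm, ← sub_eq_zero,
    sum_levels_add_indicator (ν := fun B => h (P B).toReal) (by simp [h0]) hN hN']
  refine Finset.sum_eq_zero fun k _ => ?_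
  have hsub : {ω | k + 1 ≤ N ω} ⊆ {ω | k ≤ N ω} := fun ω hω => Nat.le_of_succ_le hω
  rcases hcomp (k + 1) with hA | hA
  · have hB : {ω | k ≤ N ω} ∩ A ⊆ {ω | k + 1 ≤ N ω} := inter_subset_right.trans hA
    rw [union_eq_left.2 hB, inter_eq_right.2 hB, sub_self]
  · have hB : {ω | k + 1 ≤ N ω} ⊆ {ω | k ≤ N ω} ∩ A := subset_inter hsub hA
    rw [union_eq_right.2 hB, inter_eq_left.2 hB, add_comm, sub_self]

lemma choquet_min_succ [IsProbabilityMeasure P] (hm : MonotoneOn h (Icc (0:ℝ) 1))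
    (h0 : h 0 = 0) (h1 : h 1 = 1) (N : Ω → ℕ) (K : ℕ) :
    choquet h P (fun ω => ((min (N ω) (K + 1) : ℕ) : ℝ))
      = choquet h P (fun ω => ((min (N ω) K : ℕ) : ℝ)) + h (P {ω | K + 1 ≤ N ω}).toReal := by
  refine choquet_add_indicator_eq hm h0 h1 (fun ω => min_le_right _ K)
    (min_succ_eq_add_indicator N K) fun k => ?_
  rcases le_or_gt k K with hk | hk
  · refine Or.inl fun ω hω => ?_
    simp only [mem_ofPred_eq] at hω ⊢
    omega
  · refine Or.inr fun ω hω => ?_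
    simp only [mem_ofPred_eq] at hω ⊢
    omega

lemma choquet_zero [IsProbabilityMeasure P] (hm : MonotoneOn h (Icc (0:ℝ) 1))
    (h0 : h 0 = 0) (h1 : h 1 = 1) : choquet h P (fun _ => (0:ℝ)) = 0 := by
  have := choquet_natCast (P := P) (N := fun _ => 0) (M := 0) hm h0 h1 (fun _ => le_rfl)
  simpa using this

lemma choquet_natCast_add_le [IsProbabilityMeasure P] (hm : MonotoneOn h (Icc (0:ℝ) 1))
    (hc : ConcaveOn ℝ (Icc (0:ℝ) 1) h) (h0 : h 0 = 0) (h1 : h 1 = 1) {N L : Ω → ℕ} {M K : ℕ}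
    (hNm : Measurable N) (hLm : Measurable L) (hN : ∀ ω, N ω ≤ M) (hL : ∀ ω, L ω ≤ K) :
    choquet h P (fun ω => ((N ω + L ω : ℕ) : ℝ))
      ≤ choquet h P (fun ω => (N ω : ℝ)) + choquet h P (fun ω => (L ω : ℝ)) := by
  have key : ∀ j, choquet h P (fun ω => ((N ω + min (L ω) j : ℕ) : ℝ))
      ≤ choquet h P (fun ω => (N ω : ℝ)) + choquet h P (fun ω => ((min (L ω) j : ℕ) : ℝ)) := by
    intro j
    induction j with
    | zero => simp [choquet_zero hm h0 h1]
    | succ j ih =>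
      have := choquet_add_indicator_le (P := P) (N := fun ω => N ω + min (L ω) j)
        (N' := fun ω => N ω + min (L ω) (j + 1)) (M := M + j) (A := {ω | j + 1 ≤ L ω})
        hm hc h0 h1 (hNm.add (hLm.min measurable_const))
        (measurableSet_le measurable_const hLm)
        (fun ω => add_le_add (hN ω) (min_le_right _ _))
        (fun ω => by rw [min_succ_eq_add_indicator, add_assoc])
      rw [choquet_min_succ hm h0 h1]
      linarith
  simpa only [min_eq_left (hL _)] using key K

lemma choquet_natCast_add_eq [IsProbabilityMeasure P] (hm : MonotoneOn h (Icc (0:ℝ) 1))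
    (h0 : h 0 = 0) (h1 : h 1 = 1) {N L : Ω → ℕ} {M K : ℕ}
    (hN : ∀ ω, N ω ≤ M) (hL : ∀ ω, L ω ≤ K) (hNL : ∀ ω ω', N ω < N ω' → L ω ≤ L ω') :
    choquet h P (fun ω => ((N ω + L ω : ℕ) : ℝ))
      = choquet h P (fun ω => (N ω : ℝ)) + choquet h P (fun ω => (L ω : ℝ)) := by
  have key : ∀ j, choquet h P (fun ω => ((N ω + min (L ω) j : ℕ) : ℝ))
      = choquet h P (fun ω => (N ω : ℝ)) + choquet h P (fun ω => ((min (L ω) j : ℕ) : ℝ)) := by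
    intro j
    induction j with
    | zero => simp [choquet_zero hm h0 h1]
    | succ j ih =>
      have := choquet_add_indicator_eq (P := P) (N := fun ω => N ω + min (L ω) j)
        (N' := fun ω => N ω + min (L ω) (j + 1)) (M := M + j) (A := {ω | j + 1 ≤ L ω})
        hm h0 h1
        (fun ω => add_le_add (hN ω) (min_le_right _ _))
        (fun ω => by rw [min_succ_eq_add_indicator, add_assoc]) (fun k => by
          by_contra hcon
          simp only [not_or, not_subset, mem_ofPred_eq] at hcon
          obtain ⟨⟨ω, h1, h2⟩, ω', h3, h4⟩ := hcon
          have := hNL ω ω' (by omega)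
          omega)
      rw [choquet_min_succ hm h0 h1, this, ih, add_assoc]
  simpa only [min_eq_left (hL _)] using key K

end Choquet

/-- Monotone, cash-additive and positively homogeneous functionals on bounded measurable
functions. -/
structure IsHomogeneousMonetary {Ω : Type*} [MeasurableSpace Ω] (Φ : (Ω → ℝ) → ℝ) : Prop where
  mono : ∀ X Y : Ω → ℝ, BddMeas X → BddMeas Y → (∀ ω, X ω ≤ Y ω) → Φ X ≤ Φ Y
  add_const : ∀ X : Ω → ℝ, BddMeas X → ∀ m : ℝ, Φ (fun ω => X ω + m) = Φ X + m
  const_mul : ∀ X : Ω → ℝ, BddMeas X → ∀ l : ℝ, 0 < l → Φ (fun ω => l * X ω) = l * Φ X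

section Approximation

variable {Ω : Type*} [MeasurableSpace Ω] {X Y : Ω → ℝ} {Φ : (Ω → ℝ) → ℝ}

lemma BddMeas.exists_bound (hX : BddMeas X) : ∃ C : ℝ, 0 ≤ C ∧ ∀ ω, |X ω| ≤ C := by
  obtain ⟨-, C, hC⟩ := hX
  exact ⟨max C 0, le_max_right _ _, fun ω => (hC ω).trans (le_max_left _ _)⟩

lemma BddMeas.add_const (hX : BddMeas X) (m : ℝ) : BddMeas fun ω => X ω + m := by
  obtain ⟨hXm, C, hC⟩ := hX
  exact ⟨hXm.add_const m, C + |m|, fun ω => (abs_add_le _ _).trans (by gcongr; exact hC ω)⟩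

lemma BddMeas.const_mul (hX : BddMeas X) (l : ℝ) : BddMeas fun ω => l * X ω := by
  obtain ⟨hXm, C, hC⟩ := hX
  exact ⟨hXm.const_mul l, |l| * C, fun ω => by rw [abs_mul]; gcongr; exact hC ω⟩

lemma BddMeas.add (hX : BddMeas X) (hY : BddMeas Y) : BddMeas fun ω => X ω + Y ω := by
  obtain ⟨hXm, C, hC⟩ := hX
  obtain ⟨hYm, D, hD⟩ := hY
  exact ⟨hXm.add hYm, C + D, fun ω => (abs_add_le _ _).trans (add_le_add (hC ω) (hD ω))⟩

lemma measurable_discretize (hX : Measurable X) (C : ℝ) (n : ℕ) :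
    Measurable (discretize X C n) :=
  Nat.measurable_floor.comp ((hX.add_const C).const_mul _)

lemma bddMeas_discretize (hX : BddMeas X) {C : ℝ} (hC : ∀ ω, |X ω| ≤ C) (n : ℕ) :
    BddMeas fun ω => (discretize X C n ω : ℝ) :=
  bddMeas_natCast (measurable_discretize hX.1 C n) (discretize_le hC n)

namespace IsHomogeneousMonetary

lemma map_affine (hΦ : IsHomogeneousMonetary Φ) (hX : BddMeas X) (C : ℝ) {n : ℕ} (hn : 0 < n) :
    Φ (fun ω => (n : ℝ) * (X ω + C)) = n * (Φ X + C) := by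
  rw [hΦ.const_mul _ (hX.add_const C) _ (Nat.cast_pos.2 hn), hΦ.add_const _ hX]

lemma le_mul_of_le (hΦ : IsHomogeneousMonetary Φ) (hX : BddMeas X) (hY : BddMeas Y) (C : ℝ)
    {n : ℕ} (hn : 0 < n) (h : ∀ ω, Y ω ≤ n * (X ω + C)) : Φ Y ≤ n * (Φ X + C) := by
  rw [← hΦ.map_affine hX C hn]
  exact hΦ.mono _ _ hY ((hX.add_const C).const_mul _) h

lemma mul_le_of_le (hΦ : IsHomogeneousMonetary Φ) (hX : BddMeas X) (hY : BddMeas Y) (C m : ℝ)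
    {n : ℕ} (hn : 0 < n) (h : ∀ ω, n * (X ω + C) ≤ Y ω + m) : n * (Φ X + C) ≤ Φ Y + m := by
  rw [← hΦ.map_affine hX C hn, ← hΦ.add_const _ hY]
  exact hΦ.mono _ _ ((hX.add_const C).const_mul _) (hY.add_const m) h

end IsHomogeneousMonetary

lemma le_of_forall_nat_mul_le {a b c : ℝ} (h : ∀ n : ℕ, 0 < n → n * a ≤ n * b + c) :
    a ≤ b := by
  by_contra! hlt
  obtain ⟨n, hn⟩ := exists_nat_gt (|c| / (a - b))
  have hpos : 0 < a - b := sub_pos.2 hlt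
  have hn0 : (0:ℝ) < n := lt_of_le_of_lt (by positivity) hn
  rw [div_lt_iff₀ hpos] at hn
  have := h n (Nat.cast_pos.1 hn0)
  linarith [le_abs_self c]

lemma IsHomogeneousMonetary.eq_of_natCast_eq {Φ' : (Ω → ℝ) → ℝ} (hΦ : IsHomogeneousMonetary Φ)
    (hΦ' : IsHomogeneousMonetary Φ')
    (heq : ∀ (N : Ω → ℕ) (M : ℕ), Measurable N → (∀ ω, N ω ≤ M) →
      Φ (fun ω => (N ω : ℝ)) = Φ' (fun ω => (N ω : ℝ)))
    (hX : BddMeas X) : Φ X = Φ' X := by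
  obtain ⟨C, -, hC⟩ := hX.exists_bound
  have hb := bddMeas_discretize hX hC
  have he := fun n => heq _ _ (measurable_discretize hX.1 C n) (discretize_le hC n)
  have hl := cast_discretize_le hC
  have hu := le_cast_discretize_add_one X C
  apply le_antisymm
  · refine le_of_forall_nat_mul_le (c := 1) fun n hn => ?_
    have h1 := hΦ.mul_le_of_le hX (hb n) C 1 hn (hu n)
    have h2 := hΦ'.le_mul_of_le hX (hb n) C hn (hl n)
    linarith [he n]
  · refine le_of_forall_nat_mul_le (c := 1) fun n hn => ?_
    have h1 := hΦ'.mul_le_of_le hX (hb n) C 1 hn (hu n)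
    have h2 := hΦ.le_mul_of_le hX (hb n) C hn (hl n)
    linarith [he n]

lemma IsHomogeneousMonetary.map_add_le (hΦ : IsHomogeneousMonetary Φ) (hX : BddMeas X)
    (hY : BddMeas Y) (hadd : ∀ (N L : Ω → ℕ) (M K : ℕ), Measurable N → Measurable L →
      (∀ ω, N ω ≤ M) → (∀ ω, L ω ≤ K) →
      Φ (fun ω => ((N ω + L ω : ℕ) : ℝ)) ≤ Φ (fun ω => (N ω : ℝ)) + Φ (fun ω => (L ω : ℝ))) :
    Φ (fun ω => X ω + Y ω) ≤ Φ X + Φ Y := by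
  obtain ⟨C, -, hC⟩ := hX.exists_bound
  obtain ⟨D, -, hD⟩ := hY.exists_bound
  refine le_of_forall_nat_mul_le (c := 2) fun n hn => ?_
  have h1 := hΦ.le_mul_of_le hX (bddMeas_discretize hX hC n) C hn (cast_discretize_le hC n)
  have h2 := hΦ.le_mul_of_le hY (bddMeas_discretize hY hD n) D hn (cast_discretize_le hD n)
  have h3 := hadd _ _ _ _ (measurable_discretize hX.1 C n) (measurable_discretize hY.1 D n)
    (discretize_le hC n) (discretize_le hD n)
  simp only [Nat.cast_add] at h3
  have h4 := hΦ.mul_le_of_le (hX.add hY)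
    ((bddMeas_discretize hX hC n).add (bddMeas_discretize hY hD n)) (C + D) 2 hn fun ω => by
      linarith [le_cast_discretize_add_one X C n ω, le_cast_discretize_add_one Y D n ω]
  linarith

lemma IsHomogeneousMonetary.map_add_eq (hΦ : IsHomogeneousMonetary Φ) (hX : BddMeas X)
    (hY : BddMeas Y) (hXY : Comonotone X Y)
    (hadd : ∀ (N L : Ω → ℕ) (M K : ℕ), (∀ ω, N ω ≤ M) → (∀ ω, L ω ≤ K) →
      (∀ ω ω', N ω < N ω' → L ω ≤ L ω') →
      Φ (fun ω => ((N ω + L ω : ℕ) : ℝ)) = Φ (fun ω => (N ω : ℝ)) + Φ (fun ω => (L ω : ℝ))) :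
    Φ (fun ω => X ω + Y ω) = Φ X + Φ Y := by
  obtain ⟨C, -, hC⟩ := hX.exists_bound
  obtain ⟨D, -, hD⟩ := hY.exists_bound
  have hXb := bddMeas_discretize hX hC
  have hYb := bddMeas_discretize hY hD
  have h3 : ∀ n, Φ (fun ω => (discretize X C n ω : ℝ) + (discretize Y D n ω : ℝ))
      = Φ (fun ω => (discretize X C n ω : ℝ)) + Φ (fun ω => (discretize Y D n ω : ℝ)) := by
    intro n
    simp only [← Nat.cast_add]
    refine hadd _ _ _ _ (discretize_le hC n) (discretize_le hD n) fun ω ω' hlt => ?_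
    have hX' : X ω < X ω' := by
      by_contra! hle
      refine absurd hlt (not_lt.2 (Nat.floor_le_floor ?_))
      gcongr
    have hY' : Y ω ≤ Y ω' := by
      have := hXY ω ω'
      by_contra! hlt'
      nlinarith
    refine Nat.floor_le_floor ?_
    gcongr
  apply le_antisymm
  · refine le_of_forall_nat_mul_le (c := 2) fun n hn => ?_
    have h1 := hΦ.le_mul_of_le hX (hXb n) C hn (cast_discretize_le hC n)
    have h2 := hΦ.le_mul_of_le hY (hYb n) D hn (cast_discretize_le hD n)
    have h4 := hΦ.mul_le_of_le (hX.add hY) ((hXb n).add (hYb n)) (C + D) 2 hn fun ω => by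
      linarith [le_cast_discretize_add_one X C n ω, le_cast_discretize_add_one Y D n ω]
    linarith [h3 n]
  · refine le_of_forall_nat_mul_le (c := 2) fun n hn => ?_
    have h1 := hΦ.mul_le_of_le hX (hXb n) C 1 hn (le_cast_discretize_add_one X C n)
    have h2 := hΦ.mul_le_of_le hY (hYb n) D 1 hn (le_cast_discretize_add_one Y D n)
    have h4 := hΦ.le_mul_of_le (hX.add hY) ((hXb n).add (hYb n)) (C + D) hn fun ω => by
      linarith [cast_discretize_le hC n ω, cast_discretize_le hD n ω]
    linarith [h3 n]

end Approximation

lemma isHomogeneousMonetary_choquet {Ω : Type*} [MeasurableSpace Ω] {h : ℝ → ℝ} {P : Measure Ω}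
    [IsProbabilityMeasure P] (hm : MonotoneOn h (Icc (0:ℝ) 1)) (h0 : h 0 = 0) (h1 : h 1 = 1) :
    IsHomogeneousMonetary (choquet h P) where
  mono _ _ hX hY := choquet_mono hm h0 h1 hX hY
  add_const _ hX := choquet_add_const hm h0 h1 hX
  const_mul _ hX _ hl := choquet_const_mul hm h0 h1 hX hl

lemma choquet_congr_map {Ω : Type*} [MeasurableSpace Ω] {P Q : Measure Ω} {X Y : Ω → ℝ}
    (h : ℝ → ℝ) (hX : Measurable X) (hY : Measurable Y) (hlaw : P.map X = Q.map Y) :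
    choquet h P X = choquet h Q Y := by
  have : ∀ x, P {ω | x ≤ X ω} = Q {ω | x ≤ Y ω} := fun x => by
    have := congrArg (fun μ => μ (Ici x)) hlaw
    simp only [Measure.map_apply hX measurableSet_Ici,
      Measure.map_apply hY measurableSet_Ici] at this
    exact this
  simp only [choquet, this]

section Indicator

variable {Ω : Type*} [MeasurableSpace Ω] {P Q : Measure Ω}

lemma bddMeas_indicator_one {A : Set Ω} (hA : MeasurableSet A) :
    BddMeas (A.indicator (1 : Ω → ℝ)) :=
  ⟨measurable_one.indicator hA, 1, fun ω => by by_cases hω : ω ∈ A <;> simp [hω]⟩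

open scoped Classical in
lemma map_indicator_one_eq [IsProbabilityMeasure P] [IsProbabilityMeasure Q] {A B : Set Ω}
    (hA : MeasurableSet A) (hB : MeasurableSet B) (hAB : P A = Q B) :
    P.map (A.indicator (1 : Ω → ℝ)) = Q.map (B.indicator (1 : Ω → ℝ)) := by
  have hAB' : P Aᶜ = Q Bᶜ := by rw [prob_compl_eq_one_sub hA, prob_compl_eq_one_sub hB, hAB]
  have hpre : ∀ (C : Set Ω) (s : Set ℝ), C.indicator (1 : Ω → ℝ) ⁻¹' s
      = if (1:ℝ) ∈ s then (if (0:ℝ) ∈ s then univ else C)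
        else (if (0:ℝ) ∈ s then Cᶜ else ∅) := by
    intro C s
    ext ω
    by_cases hω : ω ∈ C <;> by_cases h1 : (1:ℝ) ∈ s <;> by_cases h0 : (0:ℝ) ∈ s <;>
      simp [hω, h1, h0]
  ext s hs
  rw [Measure.map_apply (measurable_one.indicator hA) hs,
    Measure.map_apply (measurable_one.indicator hB) hs, hpre, hpre]
  split_ifs <;> simp [hAB, hAB']

lemma measure_preimage_of_map_eq_unif01 {U : Ω → ℝ} (hU : Measurable U) (hPU : P.map U = unif01)
    {s : Set ℝ} (hs : MeasurableSet s) : P (U ⁻¹' s) = volume (s ∩ Icc 0 1) := by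
  rw [← Measure.map_apply hU hs, hPU, unif01, Measure.restrict_apply hs]

lemma measure_preimage_Iic {U : Ω → ℝ} (hU : Measurable U) (hPU : P.map U = unif01)
    {t : ℝ} (ht : t ∈ Icc (0:ℝ) 1) : P (U ⁻¹' Iic t) = ENNReal.ofReal t := by
  rw [measure_preimage_of_map_eq_unif01 hU hPU measurableSet_Iic]
  have : Iic t ∩ Icc (0:ℝ) 1 = Icc 0 t := by
    ext x
    simp only [mem_inter_iff, mem_Iic, mem_Icc]
    exact ⟨fun h => ⟨h.2.1, h.1⟩, fun h => ⟨h.2, h.1, h.2.trans ht.2⟩⟩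
  rw [this, Real.volume_Icc, sub_zero]

lemma measure_preimage_Iic_union_Ioc {U : Ω → ℝ} (hU : Measurable U) (hPU : P.map U = unif01)
    {c m d : ℝ} (hc : 0 ≤ c) (hcm : c ≤ m) (hmd : m ≤ d) (hd : d ≤ 1) :
    P (U ⁻¹' (Iic c ∪ Ioc m d)) = ENNReal.ofReal (c + (d - m)) := by
  have hdisj : Disjoint (U ⁻¹' Iic c) (U ⁻¹' Ioc m d) :=
    Disjoint.preimage _ (Set.disjoint_left.2 fun x hx hx' => by
      simp only [mem_Iic, mem_Ioc] at hx hx'; linarith)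
  have hsub : Ioc m d ⊆ Icc 0 1 := fun x hx => ⟨by linarith [hx.1], by linarith [hx.2]⟩
  rw [preimage_union, measure_union hdisj (hU measurableSet_Ioc),
    measure_preimage_Iic hU hPU ⟨hc, by linarith⟩,
    measure_preimage_of_map_eq_unif01 hU hPU measurableSet_Ioc,
    inter_eq_left.2 hsub,
    Real.volume_Ioc, ENNReal.ofReal_add hc (by linarith)]

end Indicator

lemma concaveOn_of_midpoint_of_bounded {h : ℝ → ℝ}
    (hb : ∀ x ∈ Icc (0:ℝ) 1, h x ∈ Icc (0:ℝ) 1)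
    (hmid : ∀ x ∈ Icc (0:ℝ) 1, ∀ y ∈ Icc (0:ℝ) 1, h x + h y ≤ 2 * h ((x + y) / 2)) :
    ConcaveOn ℝ (Icc (0:ℝ) 1) h := by
  have hconv : Convex ℝ (Icc (0:ℝ) 1) := convex_Icc 0 1
  refine ⟨hconv, fun x hx y hy a b ha hb' hab => ?_⟩
  have hmem : ∀ t : ℝ, 0 ≤ t → t ≤ 1 → (1 - t) * x + t * y ∈ Icc (0:ℝ) 1 := fun t h0 h1 => by
    simpa using hconv hx hy (sub_nonneg.2 h1) h0 (sub_add_cancel 1 t)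
  have key : ∀ (n : ℕ) (t : ℝ), 0 ≤ t → t ≤ 1 →
      (1 - t) * h x + t * h y - h ((1 - t) * x + t * y) ≤ (1 / 2) ^ n := by
    intro n
    induction n with
    | zero =>
      intro t h0 h1
      have := (hb _ (hmem t h0 h1)).1
      have := (hb x hx).2
      have := (hb y hy).2
      simp only [pow_zero]
      nlinarith
    | succ n ih =>
      intro t h0 h1
      rw [pow_succ]
      rcases le_total t (1 / 2) with ht | ht
      · have h2 := ih (2 * t) (by linarith) (by linarith)
        have h3 := hmid x hx _ (hmem (2 * t) (by linarith) (by linarith))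
        rw [show (x + ((1 - 2 * t) * x + 2 * t * y)) / 2 = (1 - t) * x + t * y by ring] at h3
        linarith
      · have h2 := ih (2 * t - 1) (by linarith) (by linarith)
        have h3 := hmid y hy _ (hmem (2 * t - 1) (by linarith) (by linarith))
        rw [show (y + ((1 - (2 * t - 1)) * x + (2 * t - 1) * y)) / 2
          = (1 - t) * x + t * y by ring] at h3
        linarith
  have hlim := ge_of_tendsto' (tendsto_pow_atTop_nhds_zero_of_lt_one (r := (1 / 2 : ℝ))
    (by norm_num) (by norm_num)) fun n => key n b hb' (by linarith)
  obtain rfl : a = 1 - b := by linarith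
  simp only [smul_eq_mul]
  linarith

lemma comonotone_indicator_of_subset {Ω : Type*} {A B : Set Ω} (hAB : A ⊆ B) :
    Comonotone (B.indicator (1 : Ω → ℝ)) (A.indicator (1 : Ω → ℝ)) := by
  intro ω ω'
  have h1 := @hAB ω
  have h2 := @hAB ω'
  by_cases ha : ω ∈ A <;> by_cases hb : ω ∈ B <;> by_cases ha' : ω' ∈ A <;>
    by_cases hb' : ω' ∈ B <;> simp_all

lemma comonotone_min_indicator {Ω : Type*} (N : Ω → ℕ) (K : ℕ) :
    Comonotone (fun ω => ((min (N ω) K : ℕ) : ℝ))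
      ({ω | K + 1 ≤ N ω}.indicator (1 : Ω → ℝ)) := by
  intro ω ω'
  have hle : ∀ ω, ((min (N ω) K : ℕ) : ℝ) ≤ K := fun ω => Nat.cast_le.2 (min_le_right _ _)
  have heq : ∀ ω, K + 1 ≤ N ω → ((min (N ω) K : ℕ) : ℝ) = K := fun ω hω => by
    rw [min_eq_right (by omega)]
  beta_reduce
  by_cases h : ω ∈ {ω | K + 1 ≤ N ω} <;> by_cases h' : ω' ∈ {ω | K + 1 ≤ N ω}
  · rw [indicator_of_mem h, indicator_of_mem h']
    simp
  · rw [heq ω h, indicator_of_mem h, indicator_of_notMem h', Pi.one_apply]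
    linarith [hle ω']
  · rw [heq ω' h', indicator_of_notMem h, indicator_of_mem h', Pi.one_apply]
    linarith [hle ω]
  · rw [indicator_of_notMem h, indicator_of_notMem h']
    simp

lemma concaveOn_of_subadditive_of_comonotone {Ω : Type*} [MeasurableSpace Ω]
    {Φ : (Ω → ℝ) → ℝ} {P : Measure Ω} {h : ℝ → ℝ} {U : Ω → ℝ} (hU : Measurable U)
    (hPU : P.map U = unif01) (hb : ∀ x ∈ Icc (0:ℝ) 1, h x ∈ Icc (0:ℝ) 1)
    (hind : ∀ A : Set Ω, MeasurableSet A → Φ (A.indicator 1) = h (P A).toReal)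
    (hsub : ∀ X Y : Ω → ℝ, BddMeas X → BddMeas Y → Φ (fun ω => X ω + Y ω) ≤ Φ X + Φ Y)
    (hcom : ∀ X Y : Ω → ℝ, BddMeas X → BddMeas Y → Comonotone X Y →
      Φ (fun ω => X ω + Y ω) = Φ X + Φ Y) :
    ConcaveOn ℝ (Icc (0:ℝ) 1) h := by
  have hIic : ∀ t ∈ Icc (0:ℝ) 1, Φ ((U ⁻¹' Iic t).indicator 1) = h t := fun t ht => by
    rw [hind _ (hU measurableSet_Iic), measure_preimage_Iic hU hPU ht,
      ENNReal.toReal_ofReal ht.1]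
  refine concaveOn_of_midpoint_of_bounded hb fun x hx y hy => ?_
  wlog hxy : x ≤ y generalizing x y
  · rw [add_comm (h x), add_comm x]
    exact this y hy x hx (le_of_not_ge hxy)
  have hxm : x ≤ (x + y) / 2 := by linarith
  have hmy : (x + y) / 2 ≤ y := by linarith
  set m := (x + y) / 2 with hm
  have hAm : MeasurableSet (U ⁻¹' Iic m) := hU measurableSet_Iic
  have hBm : MeasurableSet (U ⁻¹' (Iic x ∪ Ioc m y)) :=
    hU (measurableSet_Iic.union measurableSet_Ioc)
  have hB : Φ ((U ⁻¹' (Iic x ∪ Ioc m y)).indicator 1) = h m := by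
    rw [hind _ hBm, measure_preimage_Iic_union_Ioc hU hPU hx.1 hxm hmy hy.2,
      show x + (y - m) = m by rw [hm]; ring, ENNReal.toReal_ofReal (hx.1.trans hxm)]
  have hfun : (fun ω => (U ⁻¹' Iic y).indicator (1 : Ω → ℝ) ω + (U ⁻¹' Iic x).indicator 1 ω)
      = fun ω => (U ⁻¹' Iic m).indicator (1 : Ω → ℝ) ω
        + (U ⁻¹' (Iic x ∪ Ioc m y)).indicator 1 ω := by
    funext ω
    rcases le_or_gt (U ω) x with h1 | h1
    · have h2 := h1.trans hxm
      simp [indicator, h1, h2, h2.trans hmy]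
    rcases le_or_gt (U ω) m with h2 | h2
    · simp [indicator, h1.not_ge, h2, h2.trans hmy, h2.not_gt]
    rcases le_or_gt (U ω) y with h3 | h3
    · simp [indicator, h1.not_ge, h2.not_ge, h2, h3]
    · simp [indicator, h1.not_ge, h2.not_ge, h3.not_ge]
  have e1 := hcom _ _ (bddMeas_indicator_one (hU (measurableSet_Iic (a := y))))
    (bddMeas_indicator_one (hU (measurableSet_Iic (a := x))))
    (comonotone_indicator_of_subset (preimage_mono (Iic_subset_Iic.2 hxy)))
  have e2 := hsub _ _ (bddMeas_indicator_one hAm) (bddMeas_indicator_one hBm)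
  rw [hfun, hIic y hy, hIic x hx] at e1
  rw [hB, hIic m ⟨hx.1.trans hxm, hmy.trans hy.2⟩] at e2
  linarith

lemma eq_choquet_of_indicator {Ω : Type*} [MeasurableSpace Ω]
    {Φ : (Ω → ℝ) → ℝ} {P : Measure Ω} [IsProbabilityMeasure P] {h : ℝ → ℝ}
    (hm : MonotoneOn h (Icc (0:ℝ) 1)) (h0 : h 0 = 0) (h1 : h 1 = 1)
    (hΦ : IsHomogeneousMonetary Φ) (hzero : Φ (fun _ => 0) = 0)
    (hind : ∀ A : Set Ω, MeasurableSet A → Φ (A.indicator 1) = h (P A).toReal)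
    (hcom : ∀ X Y : Ω → ℝ, BddMeas X → BddMeas Y → Comonotone X Y →
      Φ (fun ω => X ω + Y ω) = Φ X + Φ Y) {X : Ω → ℝ} (hX : BddMeas X) :
    Φ X = choquet h P X := by
  refine hΦ.eq_of_natCast_eq (isHomogeneousMonetary_choquet hm h0 h1) (fun N M hN hM => ?_) hX
  have key : ∀ K, Φ (fun ω => ((min (N ω) K : ℕ) : ℝ))
      = choquet h P (fun ω => ((min (N ω) K : ℕ) : ℝ)) := by
    intro K
    induction K with
    | zero => simp [hzero, choquet_zero hm h0 h1]
    | succ K ih =>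
      have hA : MeasurableSet {ω | K + 1 ≤ N ω} := measurableSet_le measurable_const hN
      have hfun : (fun ω => ((min (N ω) (K + 1) : ℕ) : ℝ))
          = fun ω => ((min (N ω) K : ℕ) : ℝ) + {ω | K + 1 ≤ N ω}.indicator 1 ω := by
        funext ω
        rw [min_succ_eq_add_indicator, Nat.cast_add]
        simp [indicator]
      rw [choquet_min_succ hm h0 h1, ← ih, ← hind _ hA, hfun]
      exact hcom _ _ (bddMeas_natCast (hN.min measurable_const) fun ω => min_le_right _ K)
        (bddMeas_indicator_one hA) (comonotone_min_indicator N K)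
  simpa only [min_eq_left (hM _)] using key M

/-- Theorem (strongly law-invariant coherent comonotonic-additive cores are concave
distortion risk measures): a core `Ψ` satisfies (B1) and (C1)-(C5) iff it is the Choquet
integral with respect to `h ∘ P` for an increasing concave distortion `h` with
`h(0) = 0` and `h(1) = 1`. -/
theorem distortion_characterization_coherent {Ω : Type*} [MeasurableSpace Ω]
    (Ψ : (Ω → ℝ) → Measure Ω → ℝ) :
    ((∀ X Y : Ω → ℝ, BddMeas X → BddMeas Y → ∀ P Q : Measure Ω,
        IsAtomlessProb P → IsAtomlessProb Q → P.map X = Q.map Y → Ψ X P = Ψ Y Q) ∧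
      (∀ X Y : Ω → ℝ, BddMeas X → BddMeas Y → ∀ P : Measure Ω, IsAtomlessProb P →
        (∀ ω, X ω ≤ Y ω) → Ψ X P ≤ Ψ Y P) ∧
      (∀ X : Ω → ℝ, BddMeas X → ∀ P : Measure Ω, IsAtomlessProb P → ∀ m : ℝ,
        Ψ (fun ω => X ω + m) P = Ψ X P + m) ∧
      (∀ X : Ω → ℝ, BddMeas X → ∀ P : Measure Ω, IsAtomlessProb P → ∀ l : ℝ, 0 < l →
        Ψ (fun ω => l * X ω) P = l * Ψ X P) ∧
      (∀ X Y : Ω → ℝ, BddMeas X → BddMeas Y → ∀ P : Measure Ω, IsAtomlessProb P →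
        Ψ (fun ω => X ω + Y ω) P ≤ Ψ X P + Ψ Y P) ∧
      (∀ X Y : Ω → ℝ, BddMeas X → BddMeas Y → ∀ P : Measure Ω, IsAtomlessProb P →
        Comonotone X Y → Ψ (fun ω => X ω + Y ω) P = Ψ X P + Ψ Y P))
    ↔
    (∃ h : ℝ → ℝ, MonotoneOn h (Icc (0:ℝ) 1) ∧ ConcaveOn ℝ (Icc (0:ℝ) 1) h ∧
      h 0 = 0 ∧ h 1 = 1 ∧
      ∀ X : Ω → ℝ, BddMeas X → ∀ P : Measure Ω, IsAtomlessProb P →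
        Ψ X P = choquet h P X) := by
  constructor
  · rintro ⟨hlaw, hmono, hcash, hhom, hsub, hcom⟩
    by_cases hex : ∃ P₀ : Measure Ω, IsAtomlessProb P₀
    swap
    · exact ⟨id, monotoneOn_id, concaveOn_id (convex_Icc 0 1), rfl, rfl,
        fun X _ P hP => absurd ⟨P, hP⟩ hex⟩
    obtain ⟨P₀, hP₀⟩ := hex
    obtain ⟨_, U, hU, hPU⟩ := id hP₀
    set h : ℝ → ℝ := fun t => Ψ ((U ⁻¹' Iic t).indicator 1) P₀ with hh
    have hind : ∀ P : Measure Ω, IsAtomlessProb P → ∀ A : Set Ω, MeasurableSet A →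
        Ψ (A.indicator 1) P = h (P A).toReal := by
      intro P hP A hA
      have := hP.1
      have hB : MeasurableSet (U ⁻¹' Iic (P A).toReal) := hU measurableSet_Iic
      refine hlaw _ _ (bddMeas_indicator_one hA) (bddMeas_indicator_one hB) P P₀ hP hP₀
        (map_indicator_one_eq hA hB ?_)
      rw [measure_preimage_Iic hU hPU (toReal_mem_Icc A), ENNReal.ofReal_toReal (by finiteness)]
    have hzb : BddMeas fun _ : Ω => (0:ℝ) := ⟨measurable_const, 0, by simp⟩
    have hzero : ∀ P : Measure Ω, IsAtomlessProb P → Ψ (fun _ => 0) P = 0 := by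
      intro P hP
      have := hhom _ hzb P hP 2 two_pos
      simp only [mul_zero] at this
      linarith
    have h0 : h 0 = 0 := by
      have := hind P₀ hP₀ ∅ MeasurableSet.empty
      rw [measure_empty, ENNReal.toReal_zero, indicator_empty] at this
      exact this.symm.trans (hzero P₀ hP₀)
    have h1 : h 1 = 1 := by
      have := hind P₀ hP₀ univ MeasurableSet.univ
      rw [measure_univ, ENNReal.toReal_one, indicator_univ] at this
      rw [← this]
      have hc := hcash _ hzb P₀ hP₀ 1
      simp only [hzero P₀ hP₀, zero_add] at hc
      exact hc
    have hm : MonotoneOn h (Icc (0:ℝ) 1) := fun a _ b _ hab =>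
      hmono _ _ (bddMeas_indicator_one (hU measurableSet_Iic))
        (bddMeas_indicator_one (hU measurableSet_Iic)) P₀ hP₀
        (indicator_le_indicator_of_subset (preimage_mono (Iic_subset_Iic.2 hab))
          fun _ => zero_le_one)
    have hb : ∀ x ∈ Icc (0:ℝ) 1, h x ∈ Icc (0:ℝ) 1 := fun x hx =>
      ⟨h0 ▸ hm (left_mem_Icc.2 zero_le_one) hx hx.1,
        h1 ▸ hm hx (right_mem_Icc.2 zero_le_one) hx.2⟩
    refine ⟨h, hm, concaveOn_of_subadditive_of_comonotone (Φ := fun X => Ψ X P₀) hU hPU hb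
      (hind P₀ hP₀) (fun X Y hX hY => hsub X Y hX hY P₀ hP₀)
      (fun X Y hX hY => hcom X Y hX hY P₀ hP₀), h0, h1, fun X hX P hP => ?_⟩
    have := hP.1
    exact eq_choquet_of_indicator (Φ := fun X => Ψ X P) hm h0 h1
      ⟨fun X Y hX hY => hmono X Y hX hY P hP, fun X hX => hcash X hX P hP,
        fun X hX => hhom X hX P hP⟩ (hzero P hP) (hind P hP)
      (fun X Y hX hY => hcom X Y hX hY P hP) hX
  · rintro ⟨h, hm, hc, h0, h1, hΨ⟩
    refine ⟨fun X Y hX hY P Q hP hQ hlaw => ?_, fun X Y hX hY P hP hXY => ?_,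
      fun X hX P hP m => ?_, fun X hX P hP l hl => ?_, fun X Y hX hY P hP => ?_,
      fun X Y hX hY P hP hXY => ?_⟩ <;> have := hP.1
    · rw [hΨ X hX P hP, hΨ Y hY Q hQ]
      exact choquet_congr_map h hX.1 hY.1 hlaw
    · rw [hΨ X hX P hP, hΨ Y hY P hP]
      exact choquet_mono hm h0 h1 hX hY hXY
    · rw [hΨ X hX P hP, hΨ _ (hX.add_const m) P hP]
      exact choquet_add_const hm h0 h1 hX m
    · rw [hΨ X hX P hP, hΨ _ (hX.const_mul l) P hP]
      exact choquet_const_mul hm h0 h1 hX hl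
    · rw [hΨ X hX P hP, hΨ Y hY P hP, hΨ _ (hX.add hY) P hP]
      exact (isHomogeneousMonetary_choquet hm h0 h1).map_add_le hX hY
        fun N L M K hNm hLm hN hL => choquet_natCast_add_le hm hc h0 h1 hNm hLm hN hL
    · rw [hΨ X hX P hP, hΨ Y hY P hP, hΨ _ (hX.add hY) P hP]
      exact (isHomogeneousMonetary_choquet hm h0 h1).map_add_eq hX hY hXY
        fun N L M K hN hL hNL => choquet_natCast_add_eq hm h0 h1 hN hL hNL
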